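/- arXiv:0708.1481 — 3 statements merged into one kernel-verified Lean document; each statement's English description precedes it below -/
import Mathlib

section
/- Let K be a field, S = K[x_1,...,x_n], I ⊂ S a monomial ideal, and u ∈ S a monomial which is regular on S/I. Then I is a Stanley ideal if and only if (I,u) is a Stanley ideal. -/
/-!
STATEMENT 1 (Theorem 1.1, second part): Let `K` be a field, `S = K[x_1,…,x_n]`,
`I ⊂ S` a monomial ideal, and `u ∈ S` a monomial which is regular on `S/I`.
Then `I` is a Stanley ideal (i.e. `sdepth(S/I) ≥ depth(S/I)`) if and only if
`(I,u)` is a Stanley ideal.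
-/

open MvPolynomial

noncomputable section

variable (K : Type*) [Field K] {n : ℕ}
open MvPolynomial

noncomputable section

variable (K : Type*) [Field K] {n : ℕ}

/-- A monomial ideal: an ideal generated by monomials. -/
def IsMonomialIdeal (I : Ideal (MvPolynomial (Fin n) K)) : Prop :=
  ∃ A : Set (Fin n →₀ ℕ),
    I = Ideal.span ((fun d => (monomial d (1 : K) : MvPolynomial (Fin n) K)) '' A)

/-- The Stanley space `u·K[Z]`: the `K`-subspace of `K[x_1,…,x_n]` spanned by all
monomials `u·v` where `v` is a monomial in the variables of `Z`. -/
def stanleySpace (u : Fin n →₀ ℕ) (Z : Finset (Fin n)) : Submodule K (MvPolynomial (Fin n) K) :=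
  Submodule.span K
    ((fun e => (monomial (u + e) (1 : K) : MvPolynomial (Fin n) K)) ''
      {e : Fin n →₀ ℕ | ∀ i ∉ Z, e i = 0})

/-- `I^c`: the `K`-subspace of `S` spanned by all monomials not belonging to `I`. -/
def monomialComplement (I : Ideal (MvPolynomial (Fin n) K)) :
    Submodule K (MvPolynomial (Fin n) K) :=
  Submodule.span K
    {f : MvPolynomial (Fin n) K | ∃ d : Fin n →₀ ℕ, f = monomial d (1 : K) ∧ f ∉ I}

/-- A Stanley decomposition of `S/I`: a presentation of `I^c` as a finite direct
sum of Stanley spaces. -/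
structure StanleyDecomposition (I : Ideal (MvPolynomial (Fin n) K)) where
  r : ℕ
  u : Fin r → (Fin n →₀ ℕ)
  Z : Fin r → Finset (Fin n)
  indep : iSupIndep fun i => stanleySpace K (u i) (Z i)
  sup_eq : ⨆ i, stanleySpace K (u i) (Z i) = monomialComplement K I

/-- The Stanley depth of `S/I`: the maximum, over all Stanley decompositions `D` of `S/I`,
of the minimal dimension `|Z_i|` of a Stanley space occurring in `D`. -/
def sdepth (I : Ideal (MvPolynomial (Fin n) K)) : ℕ :=
  sSup {d : ℕ | ∃ D : StanleyDecomposition K I, ∀ i, d ≤ (D.Z i).card}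


/-- The depth of `S/I` with respect to the graded maximal ideal `(x_1,…,x_n)`:
the supremum of the lengths of `S/I`-regular sequences consisting of elements
of `(x_1,…,x_n)`. -/
def quotDepth (I : Ideal (MvPolynomial (Fin n) K)) : ℕ :=
  sSup {d : ℕ | ∃ rs : List (MvPolynomial (Fin n) K), rs.length = d ∧
    (∀ f ∈ rs, f ∈ Ideal.span (Set.range (X : Fin n → MvPolynomial (Fin n) K))) ∧
    RingTheory.Sequence.IsRegular (MvPolynomial (Fin n) K ⧸ I) rs}

/-- A monomial ideal `I` is a Stanley ideal if `sdepth(S/I) ≥ depth(S/I)`. -/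
def IsStanleyIdeal (I : Ideal (MvPolynomial (Fin n) K)) : Prop :=
  quotDepth K I ≤ sdepth K I

/-- There is an `R ⧸ J`-regular chain of length `k` consisting of elements of `m`. -/
def HasRegularChain {R : Type*} [CommRing R] (m : Ideal R) : ℕ → Ideal R → Prop
  | 0, _ => True
  | k + 1, J => ∃ c ∈ m, IsSMulRegular (R ⧸ J) c ∧ HasRegularChain m k (J ⊔ Ideal.span {c})

theorem isSMulRegular_idealQuotient_iff {R : Type*} [CommRing R] {J : Ideal R} {c : R} :
    IsSMulRegular (R ⧸ J) c ↔ ∀ x, c * x ∈ J → x ∈ J :=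
  isSMulRegular_quotient_iff_mem_of_smul_mem J c

theorem mem_sup_span_singleton_iff {R : Type*} [CommRing R] {J : Ideal R} {c x : R} :
    x ∈ J ⊔ Ideal.span {c} ↔ ∃ y, x - c * y ∈ J := by
  rw [sup_comm, Ideal.mem_span_singleton_sup]
  constructor
  · rintro ⟨a, b, hb, rfl⟩
    exact ⟨a, by simpa [mul_comm] using hb⟩
  · rintro ⟨y, hy⟩
    exact ⟨y, _, hy, by ring⟩

/-- An ideal `m` contains a common nonzerodivisor on finitely many quotients as soon as it kills
no nonzero element of any of them. -/
theorem exists_mem_forall_isSMulRegular {R : Type*} [CommRing R] [IsNoetherianRing R]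
    {ι : Type*} [Finite ι] (m : Ideal R) (J : ι → Ideal R)
    (h : ∀ i x, (∀ c ∈ m, c * x ∈ J i) → x ∈ J i) :
    ∃ c ∈ m, ∀ i, IsSMulRegular (R ⧸ J i) c := by
  have hs : Subsingleton ((R ⧸ m) →ₗ[R] (Π i, R ⧸ J i)) := by
    refine subsingleton_of_forall_eq 0 fun f ↦ ?_
    have h1 : f (Ideal.Quotient.mk m 1) = 0 := by
      funext i
      obtain ⟨x, hx⟩ := Ideal.Quotient.mk_surjective (f (Ideal.Quotient.mk m 1) i)
      rw [← hx, Pi.zero_apply, Ideal.Quotient.eq_zero_iff_mem]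
      refine h i x fun c hc ↦ ?_
      have h2 : c • f (Ideal.Quotient.mk m 1) = 0 := by
        rw [← map_smul]
        have : c • Ideal.Quotient.mk m 1 = 0 := by
          rw [Algebra.smul_def, Ideal.Quotient.algebraMap_eq, ← map_mul, mul_one]
          exact Ideal.Quotient.eq_zero_iff_mem.2 hc
        rw [this, map_zero]
      have h3 := congrFun h2 i
      rw [Pi.smul_apply, ← hx, Algebra.smul_def, Ideal.Quotient.algebraMap_eq, ← map_mul] at h3
      exact Ideal.Quotient.eq_zero_iff_mem.1 h3
    ext i
    simpa using congrFun h1 i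
  obtain ⟨c, hc, hreg⟩ := IsSMulRegular.subsingleton_linearMap_iff.1 hs
  rw [Ideal.annihilator_quotient] at hc
  refine ⟨c, hc, fun i x y hxy ↦ ?_⟩
  classical
  have := @hreg (Pi.single i x) (Pi.single i y) (by
    simp only [← Pi.single_smul]
    exact congrArg _ hxy)
  exact Pi.single_injective i this

theorem IsSMulRegular.mem_of_forall_mem {R : Type*} [CommRing R] {m J : Ideal R} {c : R}
    (hc : c ∈ m) (h : IsSMulRegular (R ⧸ J) c) (x : R) (hx : ∀ c ∈ m, c * x ∈ J) : x ∈ J :=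
  isSMulRegular_idealQuotient_iff.1 h x (hx c hc)

/-- Whether `m` kills a nonzero element modulo a regular element does not depend on the
regular element. -/
theorem IsSMulRegular.forall_mem_sup_of_forall_mem_sup {R : Type*} [CommRing R] {m J : Ideal R}
    {a b : R} (ha : IsSMulRegular (R ⧸ J) a) (hb : IsSMulRegular (R ⧸ J) b) (ham : a ∈ m)
    (h : ∀ x, (∀ c ∈ m, c * x ∈ J ⊔ Ideal.span {a}) → x ∈ J ⊔ Ideal.span {a})
    (x : R) (hx : ∀ c ∈ m, c * x ∈ J ⊔ Ideal.span {b}) : x ∈ J ⊔ Ideal.span {b} := by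
  rw [isSMulRegular_idealQuotient_iff] at ha hb
  simp only [mem_sup_span_singleton_iff] at *
  obtain ⟨y, hy⟩ := hx a ham
  obtain ⟨w, hw⟩ := h y fun c hc ↦ by
    obtain ⟨z, hz⟩ := hx c hc
    refine ⟨z, hb _ ?_⟩
    have := J.sub_mem (J.mul_mem_left a hz) (J.mul_mem_left c hy)
    convert this using 1
    ring
  refine ⟨w, ha _ ?_⟩
  have := J.add_mem hy (J.mul_mem_left b hw)
  convert this using 1
  ring

theorem IsSMulRegular.swap_sup_span {R : Type*} [CommRing R] {J : Ideal R} {a b : R}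
    (ha : IsSMulRegular (R ⧸ J) a) (hb : IsSMulRegular (R ⧸ (J ⊔ Ideal.span {a})) b) :
    IsSMulRegular (R ⧸ (J ⊔ Ideal.span {b})) a := by
  rw [isSMulRegular_idealQuotient_iff] at *
  simp only [mem_sup_span_singleton_iff] at *
  rintro x ⟨y, hy⟩
  obtain ⟨z, hz⟩ := hb y ⟨x, by simpa using J.neg_mem hy⟩
  refine ⟨z, ha _ ?_⟩
  have := J.add_mem hy (J.mul_mem_left b hz)
  convert this using 1
  ring

/-- Rees' exchange property: any regular element is the first member of a regular chain of
maximal length. -/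
theorem HasRegularChain.sup_span_singleton {R : Type*} [CommRing R] [IsNoetherianRing R]
    {m : Ideal R} {k : ℕ} {J : Ideal R} (h : HasRegularChain m (k + 1) J) {u : R} (hum : u ∈ m)
    (hu : IsSMulRegular (R ⧸ J) u) : HasRegularChain m k (J ⊔ Ideal.span {u}) := by
  induction k generalizing J u with
  | zero => trivial
  | succ k ih =>
    obtain ⟨r, hrm, hr, hrest⟩ := h
    have hrest' := hrest
    obtain ⟨s, hsm, hs, -⟩ := hrest'
    obtain ⟨c, hcm, hc⟩ := exists_mem_forall_isSMulRegular m
      ![J, J ⊔ Ideal.span {r}, J ⊔ Ideal.span {u}] (by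
        intro i
        fin_cases i
        · exact hr.mem_of_forall_mem hrm
        · exact hs.mem_of_forall_mem hsm
        · exact hr.forall_mem_sup_of_forall_mem_sup hu hrm (hs.mem_of_forall_mem hsm))
    have hcJ : IsSMulRegular (R ⧸ J) c := hc 0
    have hcr : IsSMulRegular (R ⧸ (J ⊔ Ideal.span {r})) c := hc 1
    have hcu : IsSMulRegular (R ⧸ (J ⊔ Ideal.span {u})) c := hc 2
    have h1 := ih hrest hcm hcr
    rw [sup_right_comm] at h1
    have h2 := ih ⟨r, hrm, hr.swap_sup_span hcr, h1⟩ hum (hu.swap_sup_span hcu)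
    rw [sup_right_comm] at h2
    exact ⟨c, hcm, hcu, h2⟩

theorem exists_bound_hasRegularChain {R : Type*} [CommRing R] [IsNoetherianRing R]
    {m : Ideal R} (hm : m ≠ ⊤) (J : Ideal R) (hJ : J ≤ m) :
    ∃ B, ∀ k, HasRegularChain m k J → k ≤ B := by
  induction J using WellFoundedGT.induction with
  | ind J ih =>
  by_cases h1 : HasRegularChain m 1 J
  · obtain ⟨c, hcm, hc, -⟩ := h1
    have hlt : J < J ⊔ Ideal.span {c} := by
      refine lt_of_le_of_ne le_sup_left fun he ↦ hm ?_
      rw [Ideal.eq_top_iff_one]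
      have hcJ : c ∈ J := by
        rw [he]
        exact Ideal.mem_sup_right (Ideal.mem_span_singleton_self c)
      exact hJ (isSMulRegular_idealQuotient_iff.1 hc 1 (by simpa using hcJ))
    obtain ⟨B, hB⟩ := ih _ hlt (sup_le hJ ((Ideal.span_singleton_le_iff_mem m).2 hcm))
    refine ⟨B + 1, fun k hk ↦ ?_⟩
    cases k with
    | zero => omega
    | succ k => exact Nat.succ_le_succ (hB k (hk.sup_span_singleton hcm hc))
  · refine ⟨0, fun k hk ↦ ?_⟩
    cases k with
    | zero => omega
    | succ k =>
      obtain ⟨c, hcm, hc, -⟩ := hk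
      exact absurd ⟨c, hcm, hc, trivial⟩ h1

/-- Reducing `R ⧸ J` modulo `c` gives the quotient by `J + (c)`. -/
def quotSMulTopIdealQuotientEquiv {R : Type*} [CommRing R] (J : Ideal R) (c : R) :
    QuotSMulTop c (R ⧸ J) ≃ₗ[R] R ⧸ (J ⊔ Ideal.span {c}) :=
  (Submodule.quotEquivOfEq _ _ (by
    ext x
    obtain ⟨x, rfl⟩ := Submodule.mkQ_surjective J x
    rw [Submodule.mem_smul_pointwise_iff_exists, Submodule.mem_map]
    constructor
    · rintro ⟨y, -, hy⟩
      obtain ⟨y, rfl⟩ := Submodule.mkQ_surjective J y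
      exact ⟨c * y, Ideal.mem_span_singleton'.2 ⟨y, mul_comm _ _⟩, hy⟩
    · rintro ⟨y, hy, hyx⟩
      obtain ⟨z, rfl⟩ := Ideal.mem_span_singleton'.1 hy
      refine ⟨J.mkQ z, trivial, ?_⟩
      rw [← hyx, ← map_smul, smul_eq_mul, mul_comm])).trans
    (Submodule.quotientQuotientEquivQuotientSup J (Ideal.span {c}))

theorem hasRegularChain_iff_exists_isRegular {R : Type*} [CommRing R] {m : Ideal R} (hm : m ≠ ⊤)
    (k : ℕ) (J : Ideal R) (hJ : J ≤ m) :
    HasRegularChain m k J ↔ ∃ rs : List R, rs.length = k ∧ (∀ f ∈ rs, f ∈ m) ∧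
      RingTheory.Sequence.IsRegular (R ⧸ J) rs := by
  induction k generalizing J with
  | zero =>
    have : Nontrivial (R ⧸ J) :=
      Ideal.Quotient.nontrivial_iff.2 fun h ↦ hm (top_le_iff.1 (h ▸ hJ))
    exact ⟨fun _ ↦ ⟨[], rfl, by simp, .nil R _⟩, fun _ ↦ trivial⟩
  | succ k ih =>
    have key (c : R) (hc : c ∈ m) := ih (J ⊔ Ideal.span {c})
      (sup_le hJ ((Ideal.span_singleton_le_iff_mem m).2 hc))
    constructor
    · rintro ⟨c, hcm, hc, hrest⟩
      obtain ⟨rs, hlen, hrs, hreg⟩ := (key c hcm).1 hrest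
      refine ⟨c :: rs, by simp [hlen], by simpa [hcm] using hrs, ?_⟩
      rw [RingTheory.Sequence.isRegular_cons_iff]
      exact ⟨hc, ((quotSMulTopIdealQuotientEquiv J c).isRegular_congr rs).2 hreg⟩
    · rintro ⟨rs, hlen, hrs, hreg⟩
      cases rs with
      | nil => simp at hlen
      | cons c rs =>
        rw [RingTheory.Sequence.isRegular_cons_iff] at hreg
        refine ⟨c, hrs c (by simp), hreg.1, (key c (hrs c (by simp))).2
          ⟨rs, by simpa using hlen, fun f hf ↦ hrs f (by simp [hf]), ?_⟩⟩
        exact ((quotSMulTopIdealQuotientEquiv J c).isRegular_congr rs).1 hreg.2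

theorem Nat.sSup_eq_sSup_add_one {S T : Set ℕ} (hS : S.Nonempty) (hb : BddAbove S)
    (h₁ : ∀ d ∈ S, d - 1 ∈ T) (h₂ : ∀ d ∈ T, d + 1 ∈ S) : sSup S = sSup T + 1 := by
  have hT : T.Nonempty := hS.imp' (· - 1) h₁
  have hbT : BddAbove T := by
    obtain ⟨B, hB⟩ := hb
    exact ⟨B, fun d hd ↦ (Nat.le_succ d).trans (hB (h₂ d hd))⟩
  have h3 := le_csSup hbT (h₁ _ (Nat.sSup_mem hS hb))
  have h4 := le_csSup hb (h₂ _ (Nat.sSup_mem hT hbT))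
  omega

/-- The exponents of the monomials in the Stanley space `x^v K[Z]`. -/
def stanleyCone {n : ℕ} (v : Fin n →₀ ℕ) (Z : Finset (Fin n)) : Set (Fin n →₀ ℕ) :=
  {e | ∀ j, v j ≤ e j ∧ (j ∉ Z → e j = v j)}

/-- The set `T` of exponents is a finite disjoint union of cones of dimension at least `d`. -/
def HasStanleyPartition {n : ℕ} (T : Set (Fin n →₀ ℕ)) (d : ℕ) : Prop :=
  ∃ (ι : Type) (_ : Fintype ι) (v : ι → Fin n →₀ ℕ) (Z : ι → Finset (Fin n)),
    (∀ e, e ∈ T ↔ ∃ i, e ∈ stanleyCone (v i) (Z i)) ∧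
    (∀ i j e, e ∈ stanleyCone (v i) (Z i) → e ∈ stanleyCone (v j) (Z j) → i = j) ∧
    ∀ i, d ≤ (Z i).card

theorem HasStanleyPartition.iUnion {n d : ℕ} {ι : Type} [Fintype ι] {T : Set (Fin n →₀ ℕ)}
    {P : ι → Set (Fin n →₀ ℕ)} (hT : ∀ e, e ∈ T ↔ ∃ i, e ∈ P i)
    (hdisj : ∀ i j e, e ∈ P i → e ∈ P j → i = j) (h : ∀ i, HasStanleyPartition (P i) d) :
    HasStanleyPartition T d := by
  choose κ hκ v Z h1 h2 h3 using h
  refine ⟨Σ i, κ i, inferInstance, fun p ↦ v p.1 p.2, fun p ↦ Z p.1 p.2, fun e ↦ ?_, ?_,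
    fun p ↦ h3 _ _⟩
  · simp only [hT, h1, Sigma.exists]
  · rintro ⟨i, a⟩ ⟨j, b⟩ e ha hb
    obtain rfl := hdisj i j e ((h1 i e).2 ⟨a, ha⟩) ((h1 j e).2 ⟨b, hb⟩)
    obtain rfl := h2 i a b e ha hb
    rfl

theorem hasStanleyPartition_cone_not_le {n : ℕ} (u v : Fin n →₀ ℕ) (Z : Finset (Fin n)) :
    HasStanleyPartition (stanleyCone v Z ∩ {e | ¬ u ≤ e}) (Z.card - 1) := by
  by_cases hZ : ∃ j, j ∉ Z ∧ v j < u j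
  · obtain ⟨j, hjZ, hj⟩ := hZ
    refine ⟨Unit, inferInstance, fun _ ↦ v, fun _ ↦ Z, fun e ↦ ?_, fun _ _ _ _ _ ↦ rfl,
      fun _ ↦ Nat.sub_le _ _⟩
    simp only [Set.mem_inter_iff, Set.mem_ofPred_eq, exists_const, and_iff_left_iff_imp]
    intro he hle
    have := hle j
    have := (he j).2 hjZ
    omega
  · push Not at hZ
    let w : (Σ j : Fin n, Fin (u j - v j)) → Fin n →₀ ℕ := fun p ↦
      Finsupp.equivFunOnFinite.symm fun i ↦
        if i < p.1 then max (u i) (v i) else if i = p.1 then v i + p.2 else v i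
    have hw (p i) : w p i =
        if i < p.1 then max (u i) (v i) else if i = p.1 then v i + p.2 else v i := rfl
    refine ⟨Σ j : Fin n, Fin (u j - v j), inferInstance, w, fun p ↦ Z.erase p.1,
      fun e ↦ ?_, ?_, fun p ↦ Finset.pred_card_le_card_erase⟩
    · constructor
      · rintro ⟨he, hue⟩
        have hex : ∃ j, e j < u j := by
          by_contra! hcon
          exact hue fun j ↦ hcon j
        obtain ⟨j, hj, hmin⟩ := WellFounded.has_min (wellFounded_lt (α := Fin n))
          {j | e j < u j} hex
        have hj : e j < u j := hj
        have hvj := (he j).1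
        refine ⟨⟨j, ⟨e j - v j, by omega⟩⟩, fun i ↦ ?_⟩
        have hi := he i
        have hiZ := hZ i
        have hm : i < j → u i ≤ e i := fun hij ↦ by
          by_contra! hcon
          exact hmin i hcon hij
        rw [hw]
        simp only [Finset.mem_erase, not_and]
        split_ifs with h1 h2
        · have hne : i ≠ j := h1.ne
          have := hm h1
          grind
        · subst h2
          grind
        · grind
      · rintro ⟨⟨j, k⟩, he⟩
        refine ⟨fun i ↦ ?_, fun hle ↦ ?_⟩
        · have hi := he i
          have hiZ := hZ i
          rw [hw] at hi
          simp only [Finset.mem_erase, not_and] at hi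
          grind
        · have hj := (he j).2 (by simp)
          rw [hw] at hj
          have := hle j
          simp at hj
          omega
    · have hlt (p q : Σ j : Fin n, Fin (u j - v j)) (e)
          (hp : e ∈ stanleyCone (w p) (Z.erase p.1))
          (hq : e ∈ stanleyCone (w q) (Z.erase q.1)) : ¬ p.1 < q.1 := by
        intro h
        have h1 := (hp p.1).2 (by simp)
        have h2 := (hq p.1).1
        rw [hw] at h1 h2
        simp [h] at h1 h2
        omega
      rintro ⟨j, k⟩ ⟨j', k'⟩ e hp hq
      obtain rfl : j = j' := le_antisymm (not_lt.1 (hlt _ _ e hq hp)) (not_lt.1 (hlt _ _ e hp hq))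
      have h1 := (hp j).2 (by simp)
      have h2 := (hq j).2 (by simp)
      rw [hw] at h1 h2
      simp at h1 h2
      obtain rfl : k = k' := Fin.ext (by omega)
      rfl

theorem HasStanleyPartition.inter_not_le {n d : ℕ} {T : Set (Fin n →₀ ℕ)}
    (h : HasStanleyPartition T d) (u : Fin n →₀ ℕ) :
    HasStanleyPartition (T ∩ {e | ¬ u ≤ e}) (d - 1) := by
  obtain ⟨ι, _, v, Z, h1, h2, h3⟩ := h
  refine .iUnion (P := fun i ↦ stanleyCone (v i) (Z i) ∩ {e | ¬ u ≤ e}) (fun e ↦ ?_)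
    (fun i j e hi hj ↦ h2 i j e hi.1 hj.1) fun i ↦ ?_
  · simp only [Set.mem_inter_iff, h1, exists_and_right]
  · obtain ⟨κ, hκ, w, Y, g1, g2, g3⟩ := hasStanleyPartition_cone_not_le u (v i) (Z i)
    exact ⟨κ, hκ, w, Y, g1, g2, fun k ↦ (Nat.sub_le_sub_right (h3 i) 1).trans (g3 k)⟩

theorem HasStanleyPartition.of_inter_not_le {n d : ℕ} {T : Set (Fin n →₀ ℕ)} {u : Fin n →₀ ℕ}
    (hu : u ≠ 0) (hT : ∀ e e' : Fin n →₀ ℕ, (∀ j, u j = 0 → e j = e' j) → e ∈ T → e' ∈ T)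
    (h : HasStanleyPartition (T ∩ {e | ¬ u ≤ e}) d) : HasStanleyPartition T (d + 1) := by
  classical
  obtain ⟨ι, _, v, Z, h1, h2, h3⟩ := h
  obtain ⟨a, ha⟩ : ∃ a, u a ≠ 0 := by
    by_contra! hcon
    exact hu (Finsupp.ext hcon)
  obtain ⟨N, hN⟩ : ∃ N, ∀ i j, v i j < N := by
    refine ⟨(∑ i, ∑ j, v i j) + 1, fun i j ↦ Nat.lt_succ_of_le ?_⟩
    exact (Finset.single_le_sum (f := fun j ↦ v i j) (fun _ _ ↦ Nat.zero_le _)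
      (Finset.mem_univ j)).trans (Finset.single_le_sum (f := fun i ↦ ∑ j, v i j)
        (fun _ _ ↦ Nat.zero_le _) (Finset.mem_univ i))
  let s : (Fin n →₀ ℕ) → Fin n →₀ ℕ := fun e ↦ Finsupp.equivFunOnFinite.symm fun j ↦
    if j = a then 0 else if u j = 0 then e j else N
  have hs (e j) : s e j = if j = a then 0 else if u j = 0 then e j else N := rfl
  let w : ι → Fin n →₀ ℕ := fun i ↦ Finsupp.equivFunOnFinite.symm fun j ↦
    if u j = 0 then v i j else 0
  have hw (i j) : w i j = if u j = 0 then v i j else 0 := rfl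
  let good : ι → Prop := fun i ↦ v i a = 0 ∧ ∀ j, u j ≠ 0 → j ≠ a → j ∈ Z i
  have hgood (i e) (h : s e ∈ stanleyCone (v i) (Z i)) : good i := by
    refine ⟨by simpa [hs] using (h a).1, fun j hj hja ↦ ?_⟩
    by_contra hjZ
    have := (h j).2 hjZ
    rw [hs, if_neg hja, if_neg hj] at this
    exact (hN i j).ne' this
  have haZ (i) (h : good i) : a ∉ Z i := by
    intro haZ
    have hmem : v i + u ∈ stanleyCone (v i) (Z i) := fun j ↦ by
      refine ⟨by simp, fun hj ↦ ?_⟩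
      have : u j = 0 := by
        by_contra hne
        by_cases hja : j = a
        · exact hj (hja ▸ haZ)
        · exact hj (h.2 j hne hja)
      simp [this]
    exact ((h1 _).2 ⟨i, hmem⟩).2 le_add_self
  have hcone (i e) (h : good i) :
      e ∈ stanleyCone (w i) (insert a (Z i)) ↔ s e ∈ stanleyCone (v i) (Z i) := by
    refine forall_congr' fun j ↦ ?_
    have h4 := hN i j
    have h5 := h.1
    have h6 := h.2 j
    have h7 := haZ i h
    rw [hs, hw, Finset.mem_insert]
    by_cases hja : j = a
    · subst hja
      simp [ha, h5]
    · by_cases hj : u j = 0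
      · simp [hja, hj]
      · simp [hja, hj, h6 hj hja, h4.le]
  have hmemT (e) : e ∈ T ↔ ∃ i, s e ∈ stanleyCone (v i) (Z i) := by
    rw [← h1]
    have hagree (j) (hj : u j = 0) : s e j = e j := by
      have : j ≠ a := fun h ↦ ha (h ▸ hj)
      rw [hs, if_neg this, if_pos hj]
    refine ⟨fun he ↦ ⟨hT e _ (fun j hj ↦ (hagree j hj).symm) he, fun hle ↦ ha ?_⟩,
      fun he ↦ hT _ e hagree he.1⟩
    simpa [hs] using hle a
  refine ⟨{i // good i}, inferInstance, fun i ↦ w i, fun i ↦ insert a (Z i), fun e ↦ ?_, ?_, ?_⟩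
  · rw [hmemT]
    constructor
    · rintro ⟨i, hi⟩
      exact ⟨⟨i, hgood i e hi⟩, (hcone i e (hgood i e hi)).2 hi⟩
    · rintro ⟨⟨i, hi⟩, he⟩
      exact ⟨i, (hcone i e hi).1 he⟩
  · rintro ⟨i, hi⟩ ⟨j, hj⟩ e hei hej
    exact Subtype.ext (h2 i j _ ((hcone i e hi).1 hei) ((hcone j e hj).1 hej))
  · rintro ⟨i, hi⟩
    rw [Finset.card_insert_of_notMem (haZ i hi)]
    exact Nat.succ_le_succ (h3 i)

theorem hasStanleyPartition_zero {n : ℕ} (A : Finset (Fin n →₀ ℕ)) :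
    HasStanleyPartition {e | ∀ a ∈ A, ¬ a ≤ e} 0 := by
  classical
  obtain ⟨N, hN⟩ : ∃ N, ∀ a ∈ A, ∀ j, a j ≤ N := by
    refine ⟨∑ a ∈ A, ∑ j, a j, fun a ha j ↦ ?_⟩
    exact (Finset.single_le_sum (f := fun j ↦ a j) (fun _ _ ↦ Nat.zero_le _)
      (Finset.mem_univ j)).trans (Finset.single_le_sum (f := fun a : Fin n →₀ ℕ ↦ ∑ j, a j)
        (fun _ _ ↦ Nat.zero_le _) ha)
  let w : (Fin n → Fin (N + 1)) → Fin n →₀ ℕ := fun c ↦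
    Finsupp.equivFunOnFinite.symm fun j ↦ (c j : ℕ)
  have hw (c j) : w c j = c j := rfl
  have hcone (c e) : e ∈ stanleyCone (w c) (Finset.univ.filter fun j ↦ (c j : ℕ) = N) ↔
      ∀ j, (c j : ℕ) = min (e j) N := by
    refine forall_congr' fun j ↦ ?_
    have := (c j).isLt
    rw [hw]
    simp only [Finset.mem_filter, Finset.mem_univ, true_and]
    omega
  have hle (c e) (h : ∀ j, ((c : Fin n → Fin (N + 1)) j : ℕ) = min (e j) N) (a) (ha : a ∈ A) :
      a ≤ w c ↔ a ≤ e := by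
    simp only [Finsupp.le_def, hw]
    refine forall_congr' fun j ↦ ?_
    have := hN a ha j
    have := h j
    omega
  refine ⟨{c : Fin n → Fin (N + 1) // ∀ a ∈ A, ¬ a ≤ w c}, inferInstance, fun c ↦ w c,
    fun c ↦ Finset.univ.filter fun j ↦ (c.1 j : ℕ) = N, fun e ↦ ?_, ?_, fun _ ↦ Nat.zero_le _⟩
  · simp only [hcone]
    constructor
    · intro he
      let c : Fin n → Fin (N + 1) := fun j ↦ ⟨min (e j) N, by omega⟩
      have hc (j) : (c j : ℕ) = min (e j) N := rfl
      exact ⟨⟨c, fun a ha h ↦ he a ha ((hle c e hc a ha).1 h)⟩, hc⟩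
    · rintro ⟨⟨c, hcA⟩, hc⟩ a ha h
      exact hcA a ha ((hle c e hc a ha).2 h)
  · rintro ⟨c, hcA⟩ ⟨c', hcA'⟩ e h h'
    rw [hcone] at h h'
    refine Subtype.ext (funext fun j ↦ Fin.ext ?_)
    rw [h j, h' j]

theorem HasStanleyPartition.le {n d : ℕ} {T : Set (Fin n →₀ ℕ)} (h : HasStanleyPartition T d)
    (hT : T.Nonempty) : d ≤ n := by
  obtain ⟨ι, _, v, Z, h1, -, h3⟩ := h
  obtain ⟨e, he⟩ := hT
  obtain ⟨i, -⟩ := (h1 e).1 he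
  simpa using (h3 i).trans (Finset.card_le_univ _)

theorem stanleySpace_eq_span_image {K : Type*} [Field K] {n : ℕ} (v : Fin n →₀ ℕ)
    (Z : Finset (Fin n)) : stanleySpace K v Z =
      Submodule.span K (basisMonomials (Fin n) K '' stanleyCone v Z) := by
  rw [stanleySpace, coe_basisMonomials]
  congr 1
  ext f
  constructor
  · rintro ⟨e, he, rfl⟩
    exact ⟨v + e, fun j ↦ ⟨by simp, fun hj ↦ by simp [he j hj]⟩, rfl⟩
  · rintro ⟨e, he, rfl⟩
    have hle : v ≤ e := fun j ↦ (he j).1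
    exact ⟨e - v, fun j hj ↦ by simp [(he j).2 hj], by simp [add_tsub_cancel_of_le hle]⟩

theorem monomialComplement_eq_span_image {K : Type*} [Field K] {n : ℕ}
    (I : Ideal (MvPolynomial (Fin n) K)) : monomialComplement K I =
      Submodule.span K (basisMonomials (Fin n) K '' {e | monomial e (1 : K) ∉ I}) := by
  rw [monomialComplement, coe_basisMonomials]
  congr 1
  ext f
  constructor
  · rintro ⟨d, rfl, hd⟩
    exact ⟨d, hd, rfl⟩
  · rintro ⟨d, hd, rfl⟩
    exact ⟨d, rfl, hd⟩

theorem Module.Basis.span_image_injective {K V ι : Type*} [Field K] [AddCommGroup V] [Module K V]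
    (b : Module.Basis ι K V) :
    Function.Injective fun s : Set ι ↦ Submodule.span K (b '' s) := by
  intro s t h
  ext i
  rw [← b.self_mem_span_image (s := s), ← b.self_mem_span_image (s := t)]
  exact iff_of_eq (congrArg (b i ∈ ·) h)

theorem exists_stanleyDecomposition_iff {K : Type*} [Field K] {n : ℕ}
    (I : Ideal (MvPolynomial (Fin n) K)) (d : ℕ) :
    (∃ D : StanleyDecomposition K I, ∀ i, d ≤ (D.Z i).card) ↔
      HasStanleyPartition {e | monomial e (1 : K) ∉ I} d := by
  let b := basisMonomials (Fin n) K
  have hsup {r : ℕ} (v : Fin r → Fin n →₀ ℕ) (Z : Fin r → Finset (Fin n)) :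
      ⨆ i, stanleySpace K (v i) (Z i) = monomialComplement K I ↔
        ∀ e, e ∈ {e | monomial e (1 : K) ∉ I} ↔ ∃ i, e ∈ stanleyCone (v i) (Z i) := by
    simp only [stanleySpace_eq_span_image, monomialComplement_eq_span_image,
      ← Submodule.span_iUnion, ← Set.image_iUnion]
    rw [b.span_image_injective.eq_iff, Set.ext_iff]
    simp only [Set.mem_iUnion]
    exact forall_congr' fun e ↦ Iff.comm
  constructor
  · rintro ⟨⟨r, v, Z, hind, hs⟩, hd⟩
    refine ⟨Fin r, inferInstance, v, Z, (hsup v Z).1 hs, fun i j e hi hj ↦ ?_, hd⟩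
    by_contra hij
    have hdis := hind.pairwiseDisjoint hij
    simp only [Function.onFun, stanleySpace_eq_span_image] at hdis
    exact b.ne_zero e (Submodule.disjoint_def.1 hdis _ (b.self_mem_span_image.2 hi)
      (b.self_mem_span_image.2 hj))
  · rintro ⟨ι, _, v, Z, h1, h2, h3⟩
    let φ := (Fintype.equivFin ι).symm
    refine ⟨⟨Fintype.card ι, v ∘ φ, Z ∘ φ, fun i ↦ ?_, (hsup _ _).2 fun e ↦ ?_⟩, fun i ↦ h3 _⟩
    · simp only [stanleySpace_eq_span_image, ← Submodule.span_iUnion, ← Set.image_iUnion]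
      refine b.linearIndependent.disjoint_span_image ?_
      rw [Set.disjoint_left]
      intro e he he'
      simp only [Set.mem_iUnion] at he'
      obtain ⟨j, hji, hj⟩ := he'
      exact hji (φ.injective (h2 _ _ e hj he))
    · rw [h1, ← φ.exists_congr_right]
      rfl

theorem sdepth_eq_sdepth_sup_add_one {K : Type*} [Field K] {n : ℕ}
    (I : Ideal (MvPolynomial (Fin n) K)) (hI : IsMonomialIdeal K I) (hIproper : I ≠ ⊤)
    (u : Fin n →₀ ℕ) (hu : u ≠ 0)
    (hreg : IsSMulRegular (MvPolynomial (Fin n) K ⧸ I) (monomial u (1 : K))) :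
    sdepth K I = sdepth K (I ⊔ Ideal.span {monomial u (1 : K)}) + 1 := by
  classical
  have hA : ∃ A : Finset (Fin n →₀ ℕ), I = Ideal.span ((fun d ↦ monomial d (1 : K)) '' ↑A) := by
    obtain ⟨A, rfl⟩ := hI
    obtain ⟨s, hs, hspan⟩ := Submodule.fg_span_iff_fg_span_finset_subset _ |>.1
      (IsNoetherian.noetherian (Ideal.span ((fun d ↦ monomial d (1 : K)) '' A)))
    obtain ⟨A', -, rfl⟩ := Finset.subset_set_image_iff.1 hs
    exact ⟨A', by simpa using hspan⟩
  obtain ⟨A, hA⟩ := hA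
  have hmem (e : Fin n →₀ ℕ) : monomial e (1 : K) ∈ I ↔ ∃ a ∈ A, a ≤ e := by
    rw [hA, mem_ideal_span_monomial_image]
    simp [support_monomial]
  have hmem_sup (e : Fin n →₀ ℕ) : monomial e (1 : K) ∈ I ⊔ Ideal.span {monomial u (1 : K)} ↔
      monomial e (1 : K) ∈ I ∨ u ≤ e := by
    rw [hmem, hA, ← Set.image_singleton (f := fun d ↦ monomial d (1 : K)) (a := u),
      ← Ideal.span_union, ← Set.image_union, mem_ideal_span_monomial_image]
    simp [support_monomial, or_comm]
  have hT : {e | monomial e (1 : K) ∉ I ⊔ Ideal.span {monomial u (1 : K)}} =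
      {e | monomial e (1 : K) ∉ I} ∩ {e | ¬ u ≤ e} := by
    ext e
    simp [hmem_sup]
  rw [isSMulRegular_idealQuotient_iff] at hreg
  have hshift (e : Fin n →₀ ℕ) (k : ℕ) (h : monomial (k • u + e) (1 : K) ∈ I) :
      monomial e (1 : K) ∈ I := by
    induction k with
    | zero => simpa using h
    | succ k ih =>
      refine ih (hreg _ ?_)
      rw [monomial_mul, one_mul, ← add_assoc, ← succ_nsmul']
      exact h
  have hinv (e e' : Fin n →₀ ℕ) (hee : ∀ j, u j = 0 → e j = e' j)
      (he : monomial e (1 : K) ∉ I) : monomial e' (1 : K) ∉ I := by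
    intro he'
    obtain ⟨a, ha, hae⟩ := (hmem e').1 he'
    refine he (hshift e (∑ j, e' j) ((hmem _).2 ⟨a, ha, hae.trans fun j ↦ ?_⟩))
    rw [Finsupp.add_apply, Finsupp.smul_apply, smul_eq_mul]
    by_cases hj : u j = 0
    · simp [hj, hee j hj]
    · have h1 : e' j ≤ ∑ j, e' j :=
        Finset.single_le_sum (f := fun j ↦ e' j) (fun _ _ ↦ Nat.zero_le _) (Finset.mem_univ j)
      have h2 := Nat.le_mul_of_pos_right (∑ j, e' j) (Nat.pos_of_ne_zero hj)
      omega
  have hne : {e | monomial e (1 : K) ∉ I}.Nonempty := by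
    refine ⟨0, fun h ↦ hIproper (I.eq_top_iff_one.2 ?_)⟩
    simpa using h
  simp only [sdepth, exists_stanleyDecomposition_iff, hT]
  refine Nat.sSup_eq_sSup_add_one ⟨0, ?_⟩ ⟨n, fun d hd ↦ hd.le hne⟩
    (fun d hd ↦ hd.inter_not_le u) fun d hd ↦ hd.of_inter_not_le hu hinv
  have := hasStanleyPartition_zero A
  convert this using 1
  simp [hmem]

theorem quotDepth_eq_quotDepth_sup_add_one {K : Type*} [Field K] {n : ℕ}
    (I : Ideal (MvPolynomial (Fin n) K)) (hI : IsMonomialIdeal K I) (hIproper : I ≠ ⊤)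
    (u : Fin n →₀ ℕ) (hu : u ≠ 0)
    (hreg : IsSMulRegular (MvPolynomial (Fin n) K ⧸ I) (monomial u (1 : K))) :
    quotDepth K I = quotDepth K (I ⊔ Ideal.span {monomial u (1 : K)}) + 1 := by
  set m := Ideal.span (Set.range (X : Fin n → MvPolynomial (Fin n) K)) with hm_def
  have hmem (d : Fin n →₀ ℕ) (hd : d ≠ 0) : monomial d (1 : K) ∈ m := by
    rw [hm_def, ← Set.image_univ, mem_ideal_span_X_image]
    intro e he
    obtain rfl : e = d := by
      simpa using support_monomial_subset he
    obtain ⟨i, hi⟩ := Finsupp.ne_iff.1 hd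
    exact ⟨i, trivial, hi⟩
  have hm : m ≠ ⊤ := by
    rw [Ideal.ne_top_iff_one, hm_def, ← Set.image_univ, mem_ideal_span_X_image]
    intro h
    obtain ⟨i, -, hi⟩ := h 0 (by simp)
    exact hi rfl
  have hIm : I ≤ m := by
    obtain ⟨A, rfl⟩ := hI
    rw [Ideal.span_le]
    rintro _ ⟨d, hd, rfl⟩
    refine hmem d ?_
    rintro rfl
    exact hIproper (Ideal.eq_top_of_isUnit_mem _ (Ideal.subset_span ⟨0, hd, rfl⟩) (by simp))
  have hIum : I ⊔ Ideal.span {monomial u (1 : K)} ≤ m :=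
    sup_le hIm ((Ideal.span_singleton_le_iff_mem m).2 (hmem u hu))
  simp only [quotDepth, ← hm_def]
  simp only [← hasRegularChain_iff_exists_isRegular hm _ _ hIm,
    ← hasRegularChain_iff_exists_isRegular hm _ _ hIum]
  obtain ⟨B, hB⟩ := exists_bound_hasRegularChain hm I hIm
  refine Nat.sSup_eq_sSup_add_one ⟨0, trivial⟩ ⟨B, fun k hk ↦ hB k hk⟩ (fun k hk ↦ ?_)
    fun k hk ↦ ⟨_, hmem u hu, hreg, hk⟩
  cases k with
  | zero => trivial
  | succ k => exact HasRegularChain.sup_span_singleton hk (hmem u hu) hreg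

theorem isStanleyIdeal_iff_sup_regular_monomial {K : Type*} [Field K] {n : ℕ}
    (I : Ideal (MvPolynomial (Fin n) K)) (hI : IsMonomialIdeal K I) (hIproper : I ≠ ⊤)
    (u : Fin n →₀ ℕ) (hu : u ≠ 0)
    (hreg : Function.Injective fun f : MvPolynomial (Fin n) K ⧸ I =>
      (monomial u (1 : K) : MvPolynomial (Fin n) K) • f) :
    IsStanleyIdeal K I ↔
      IsStanleyIdeal K (I ⊔ Ideal.span {(monomial u (1 : K) : MvPolynomial (Fin n) K)}) := by
  rw [IsStanleyIdeal, IsStanleyIdeal,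
    quotDepth_eq_quotDepth_sup_add_one I hI hIproper u hu hreg,
    sdepth_eq_sdepth_sup_add_one I hI hIproper u hu hreg, Nat.add_le_add_iff_right]

end
end
end

section
/- Let K be a field, S = K[x_1,...,x_n], and let I ⊂ S be an ideal generated by a regular sequence of monomials u_1,...,u_k. Then I is a Stanley ideal, i.e., sdepth(S/I) ≥ depth(S/I). -/
/-!
STATEMENT 4 (Corollary 1.4): Let `K` be a field, `S = K[x_1,…,x_n]`, and let
`I ⊂ S` be an ideal generated by a regular sequence of monomials `u_1,…,u_k`.
Then `I` is a Stanley ideal, i.e. `sdepth(S/I) ≥ depth(S/I)`.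
-/

open MvPolynomial

noncomputable section

variable (K : Type*) [Field K] {n : ℕ}
open MvPolynomial

noncomputable section

variable (K : Type*) [Field K] {n : ℕ}

/-- A weakly regular sequence on a finite module over a Noetherian ring (not necessarily local)
drops the dimension by at least its length. -/
lemma supportDim_add_length_le_of_isWeaklyRegular {R : Type*} [CommRing R] [IsNoetherianRing R]
    {M : Type*} [AddCommGroup M] [Module R M] [Module.Finite R M] {rs : List R}
    (h : RingTheory.Sequence.IsWeaklyRegular M rs) :
    Module.supportDim R (M ⧸ (Ideal.ofList rs • ⊤ : Submodule R M)) + rs.length ≤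
      Module.supportDim R M := by
  induction rs generalizing M with
  | nil =>
    rw [Ideal.ofList_nil, Submodule.bot_smul]
    simpa using (Module.supportDim_eq_of_equiv (Submodule.quotEquivOfEqBot ⊥ rfl)).le
  | cons x rs ih =>
    obtain ⟨hx, hrs⟩ := (RingTheory.Sequence.isWeaklyRegular_cons_iff M x rs).mp h
    rw [Module.supportDim_eq_of_equiv (Submodule.quotOfListConsSMulTopEquivQuotSMulTopInner M x _),
      List.length_cons, Nat.cast_succ, ← add_assoc]
    exact (add_le_add_left (ih hrs) 1).trans
      (Module.supportDim_quotSMulTop_succ_le_of_notMem_minimalPrimes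
        fun _ ↦ hx.notMem_of_mem_minimalPrimes)

lemma length_le_supportDim_of_isRegular {R : Type*} [CommRing R] [IsNoetherianRing R]
    {M : Type*} [AddCommGroup M] [Module R M] [Module.Finite R M] {rs : List R}
    (h : RingTheory.Sequence.IsRegular M rs) : (rs.length : WithBot ℕ∞) ≤ Module.supportDim R M := by
  have := h.quot_ofList_smul_nontrivial ⊤
  have h0 : 0 ≤ Module.supportDim R (M ⧸ (Ideal.ofList rs • ⊤ : Submodule R M)) := by
    rw [Module.supportDim]
    have : Nonempty (Module.support R (M ⧸ (Ideal.ofList rs • ⊤ : Submodule R M))) :=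
      Module.nonempty_support_of_nontrivial.to_subtype
    exact Order.krullDim_nonneg
  calc (rs.length : WithBot ℕ∞) = 0 + rs.length := (zero_add _).symm
    _ ≤ _ := add_le_add_left h0 _
    _ ≤ _ := supportDim_add_length_le_of_isWeaklyRegular h.toIsWeaklyRegular

lemma length_add_length_le_of_isRegular_of_isRegular_quotient
    {us rs : List (MvPolynomial (Fin n) K)}
    (hus : RingTheory.Sequence.IsRegular (MvPolynomial (Fin n) K) us)
    (hrs : RingTheory.Sequence.IsRegular (MvPolynomial (Fin n) K ⧸ Ideal.ofList us) rs) :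
    rs.length + us.length ≤ n := by
  have h1 := length_le_supportDim_of_isRegular hrs
  have h2 := supportDim_add_length_le_of_isWeaklyRegular hus.toIsWeaklyRegular
  have he : (Ideal.ofList us • ⊤ : Submodule (MvPolynomial (Fin n) K) _) = Ideal.ofList us := by
    simp
  rw [Module.supportDim_eq_of_equiv (Submodule.quotEquivOfEq _ _ he),
    Module.supportDim_self_eq_ringKrullDim, MvPolynomial.ringKrullDim_of_isNoetherianRing,
    ringKrullDim_eq_zero_of_field, zero_add] at h2
  have h3 := (add_le_add_left h1 _).trans h2
  simp only [Nat.card_eq_fintype_card, Fintype.card_fin] at h3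
  exact_mod_cast h3

lemma ofList_take_ofFn {R : Type*} [CommRing R] {k : ℕ} (f : Fin k → R) (j : ℕ) :
    Ideal.ofList ((List.ofFn f).take j) = Ideal.span (f '' {i | (i : ℕ) < j}) := by
  rw [Ideal.ofList]
  congr 1
  ext r
  simp only [Set.mem_ofPred_eq, List.mem_take_iff_getElem, Set.mem_image]
  constructor
  · rintro ⟨i, hi, rfl⟩
    simp only [List.length_ofFn, lt_inf_iff] at hi
    exact ⟨⟨i, hi.2⟩, hi.1, by simp⟩
  · rintro ⟨i, hi, rfl⟩
    exact ⟨i, by simpa using hi, by simp⟩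

lemma ofList_ofFn {R : Type*} [CommRing R] {k : ℕ} (f : Fin k → R) :
    Ideal.ofList (List.ofFn f) = Ideal.span (Set.range f) := by
  rw [Ideal.ofList]
  congr 1
  ext r
  simp

lemma monomial_mem_span_image_iff {ι : Type*} (u : ι → Fin n →₀ ℕ) (s : Set ι) (d : Fin n →₀ ℕ) :
    (monomial d (1 : K) : MvPolynomial (Fin n) K) ∈
      Ideal.span ((fun i ↦ (monomial (u i) (1 : K) : MvPolynomial (Fin n) K)) '' s) ↔
      ∃ i ∈ s, u i ≤ d := by
  have := mem_ideal_span_monomial_image (x := (monomial d (1 : K))) (s := u '' s)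
  rw [Set.image_image] at this
  simpa [support_monomial] using this

/-- The monomials in a regular sequence have pairwise disjoint supports. -/
lemma eq_zero_or_eq_zero_of_isRegular_monomial {k : ℕ} {u : Fin k → Fin n →₀ ℕ}
    (hreg : RingTheory.Sequence.IsRegular (MvPolynomial (Fin n) K)
      (List.ofFn fun i ↦ (monomial (u i) (1 : K) : MvPolynomial (Fin n) K)))
    {i j : Fin k} (hij : i ≠ j) (v : Fin n) : u i v = 0 ∨ u j v = 0 := by
  have hne (l : Fin k) : u l ≠ 0 := fun h0 ↦ hreg.top_ne_smul <| by
    rw [ofList_ofFn, Ideal.smul_eq_mul, Ideal.mul_top, eq_comm, Ideal.eq_top_iff_one]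
    refine Ideal.subset_span ⟨l, ?_⟩
    simp [h0]
  have hcancel (j : Fin k) (d : Fin n →₀ ℕ) (h : ∃ i < j, u i ≤ u j + d) : ∃ i < j, u i ≤ d := by
    have hj := hreg.regular_mod_prev j (by simp)
    rw [isSMulRegular_quotient_iff_mem_of_smul_mem, ofList_take_ofFn] at hj
    have := hj (monomial d 1)
    simp only [List.getElem_ofFn, Ideal.mul_top, smul_eq_mul, monomial_mul,
      mul_one, monomial_mem_span_image_iff] at this
    exact this h
  suffices H : ∀ j, ∀ i < j, ∀ v, u i v = 0 ∨ u j v = 0 by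
    rcases lt_or_gt_of_ne hij with h | h
    · exact H j i h v
    · exact (H i j h v).symm
  intro j
  induction j using WellFoundedLT.induction with
  | ind j ih =>
    intro i hi v
    by_contra! hv
    obtain ⟨l, hl, hle⟩ := hcancel j (u i - Finsupp.single v 1) ⟨i, hi, fun w ↦ by
      by_cases hw : v = w
      · subst hw
        simp only [Finsupp.coe_add, Finsupp.coe_tsub, Pi.add_apply, Pi.sub_apply,
          Finsupp.single_eq_same]
        omega
      · simp [hw]⟩
    have hli : l ≠ i := by
      rintro rfl
      have := hle v
      simp only [Finsupp.coe_tsub, Pi.sub_apply, Finsupp.single_eq_same] at this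
      omega
    refine hne l (Finsupp.ext fun w ↦ ?_)
    have hw : u l w ≤ u i w := (hle w).trans (by simp)
    have : u l w = 0 ∨ u i w = 0 := by
      rcases lt_or_gt_of_ne hli with h | h
      · exact ih i hi l h w
      · exact (ih l hl i h w).symm
    simp only [Finsupp.coe_zero, Pi.zero_apply]
    omega

lemma iSupIndep_restrictSupport {ι σ R : Type*} [CommSemiring R] {s : ι → Set (σ →₀ ℕ)}
    (h : Pairwise (Function.onFun Disjoint s)) : iSupIndep fun i ↦ restrictSupport R (s i) := by
  intro i
  have hle : ⨆ (j) (_ : j ≠ i), restrictSupport R (s j) ≤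
      restrictSupport R (⋃ (j) (_ : j ≠ i), s j) :=
    iSup₂_le fun j hj ↦ restrictSupport_mono _ (Set.subset_biUnion_of_mem (u := s) hj)
  refine Disjoint.mono_right hle (Submodule.disjoint_def.mpr fun f hf hf' ↦ ?_)
  rw [mem_restrictSupport_iff] at hf hf'
  rw [← support_eq_empty, Finset.eq_empty_iff_forall_notMem]
  intro d hd
  obtain ⟨j, hj, hdj⟩ := Set.mem_iUnion₂.mp (hf' hd)
  exact Set.disjoint_left.mp (h hj) hdj (hf hd)

lemma iSup_restrictSupport {ι σ R : Type*} [CommSemiring R] (s : ι → Set (σ →₀ ℕ)) :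
    ⨆ i, restrictSupport R (s i) = restrictSupport R (⋃ i, s i) := by
  simp_rw [restrictSupport_eq_span, Set.image_iUnion, Submodule.span_iUnion]

lemma stanleySpace_eq_restrictSupport (b : Fin n →₀ ℕ) (Z : Finset (Fin n)) :
    stanleySpace K b Z = restrictSupport K {d | b ≤ d ∧ ∀ i ∉ Z, d i = b i} := by
  rw [restrictSupport_eq_span, stanleySpace, ← Set.image_image (fun d ↦ monomial d (1 : K))
    (fun e ↦ b + e)]
  congr 2
  ext d
  constructor
  · rintro ⟨e, he, rfl⟩
    exact ⟨le_self_add, fun i hi ↦ by simp [he i hi]⟩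
  · rintro ⟨hle, h⟩
    exact ⟨d - b, fun i hi ↦ by simp [h i hi], add_tsub_cancel_of_le hle⟩

lemma monomialComplement_eq_restrictSupport (I : Ideal (MvPolynomial (Fin n) K)) :
    monomialComplement K I = restrictSupport K {d | (monomial d (1 : K)) ∉ I} := by
  rw [restrictSupport_eq_span, monomialComplement]
  congr 1
  ext f
  constructor
  · rintro ⟨d, rfl, hd⟩
    exact ⟨d, hd, rfl⟩
  · rintro ⟨d, hd, rfl⟩
    exact ⟨d, rfl, hd⟩

/-- A finite partition of the exponents of the monomials outside `I` into translated coordinate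
orthants gives a Stanley decomposition. -/
lemma le_sdepth_of_partition {I : Ideal (MvPolynomial (Fin n) K)} (hI : I ≠ ⊤) {ι : Type*}
    [Finite ι] (b : ι → Fin n →₀ ℕ) (Z : ι → Finset (Fin n))
    (hunique : ∀ d, (monomial d (1 : K)) ∉ I → ∃! p, b p ≤ d ∧ ∀ v ∉ Z p, d v = b p v)
    (hnot : ∀ d p, b p ≤ d → (∀ v ∉ Z p, d v = b p v) → (monomial d (1 : K)) ∉ I)
    {m : ℕ} (hm : ∀ p, m ≤ (Z p).card) : m ≤ sdepth K I := by
  obtain ⟨r, ⟨e⟩⟩ := Finite.exists_equiv_fin ι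
  refine le_csSup ⟨n, ?_⟩ ⟨⟨r, b ∘ e.symm, Z ∘ e.symm, ?_, ?_⟩, fun i ↦ hm _⟩
  · rintro d ⟨D, hD⟩
    have hr : Nonempty (Fin D.r) := by
      by_contra hr
      rw [not_nonempty_iff] at hr
      have h := D.sup_eq
      rw [iSup_of_empty, monomialComplement_eq_restrictSupport] at h
      have h1 : (monomial 0 (1 : K) : MvPolynomial (Fin n) K) ∈
          restrictSupport K {d | (monomial d (1 : K)) ∉ I} :=
        (monomial_mem_restrictSupport K).mpr
          (Or.inl fun h1 ↦ hI ((Ideal.eq_top_iff_one _).mpr h1))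
      rw [← h, Submodule.mem_bot, monomial_eq_zero] at h1
      exact one_ne_zero h1
    exact (hD hr.some).trans ((Finset.card_le_univ _).trans (Fintype.card_fin n).le)
  · simp_rw [stanleySpace_eq_restrictSupport]
    refine iSupIndep_restrictSupport fun i j hij ↦ Set.disjoint_left.mpr fun d hi hj ↦ hij ?_
    exact e.symm.injective ((hunique d (hnot d _ hi.1 hi.2)).unique hi hj)
  · simp_rw [stanleySpace_eq_restrictSupport, monomialComplement_eq_restrictSupport,
      iSup_restrictSupport]
    congr 1
    ext d
    simp only [Set.mem_iUnion, Function.comp_apply]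
    constructor
    · rintro ⟨i, hi⟩
      exact hnot d _ hi.1 hi.2
    · intro hd
      obtain ⟨p, hp, -⟩ := hunique d hd
      exact ⟨e p, by simpa using hp⟩

/-- The index `p` records, for each `i`, a variable `(p i).1` and an exponent `(p i).2` less than
that of `u i`; this is the least exponent whose powers of the earlier variables are divisible by
those of `u i` and whose power of `(p i).1` is `(p i).2`, for every `i`. -/
def orthantBase {k : ℕ} (u : Fin k → Fin n →₀ ℕ) (p : ∀ i, Σ v, Fin (u i v)) : Fin n →₀ ℕ :=
  Finsupp.equivFunOnFinite.symm fun v ↦ Finset.univ.sup fun i ↦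
    if v < (p i).1 then u i v else if v = (p i).1 then ((p i).2 : ℕ) else 0

/-- The variables left free once those chosen by `p` are fixed. -/
def orthantFree {k : ℕ} (u : Fin k → Fin n →₀ ℕ) (p : ∀ i, Σ v, Fin (u i v)) : Finset (Fin n) :=
  (Finset.univ.image fun i ↦ (p i).1)ᶜ

lemma orthantBase_apply {k : ℕ} (u : Fin k → Fin n →₀ ℕ) (p : ∀ i, Σ v, Fin (u i v))
    (v : Fin n) : orthantBase u p v = Finset.univ.sup fun i ↦
      if v < (p i).1 then u i v else if v = (p i).1 then ((p i).2 : ℕ) else 0 :=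
  rfl

lemma orthantBase_apply_fst {k : ℕ} {u : Fin k → Fin n →₀ ℕ}
    (hu : ∀ i j, i ≠ j → ∀ v, u i v = 0 ∨ u j v = 0) (p : ∀ i, Σ v, Fin (u i v)) (i : Fin k) :
    orthantBase u p (p i).1 = (p i).2 := by
  rw [orthantBase_apply]
  refine le_antisymm (Finset.sup_le fun j _ ↦ ?_) ?_
  · rcases eq_or_ne j i with rfl | hji
    · simp
    · have hi := (p i).2.pos
      have hj := (p j).2.pos
      have h0 : u j (p i).1 = 0 := (hu j i hji _).resolve_right hi.ne'
      have hne : (p i).1 ≠ (p j).1 := fun h ↦ by rw [← h] at hj; omega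
      simp [h0, hne]
  · refine le_trans ?_ (Finset.le_sup (Finset.mem_univ i))
    simp

lemma mem_orthant_iff {k : ℕ} {u : Fin k → Fin n →₀ ℕ}
    (hu : ∀ i j, i ≠ j → ∀ v, u i v = 0 ∨ u j v = 0) (p : ∀ i, Σ v, Fin (u i v))
    (d : Fin n →₀ ℕ) :
    (orthantBase u p ≤ d ∧ ∀ v ∉ orthantFree u p, d v = orthantBase u p v) ↔
      ∀ i, d (p i).1 = (p i).2 ∧ ∀ v < (p i).1, u i v ≤ d v := by
  constructor
  · rintro ⟨hle, heq⟩ i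
    refine ⟨?_, fun v hv ↦ le_trans ?_ (hle v)⟩
    · rw [heq _ (by simp [orthantFree]), orthantBase_apply_fst hu]
    · rw [orthantBase_apply]
      refine le_trans ?_ (Finset.le_sup (Finset.mem_univ i))
      simp [hv]
  · intro h
    refine ⟨fun v ↦ (orthantBase_apply u p v).trans_le (Finset.sup_le fun i _ ↦ ?_), fun v hv ↦ ?_⟩
    · split_ifs with h1 h2
      · exact (h i).2 v h1
      · rw [h2, (h i).1]
      · exact Nat.zero_le _
    · obtain ⟨i, rfl⟩ : ∃ i, (p i).1 = v := by simpa [orthantFree] using hv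
      rw [(h i).1, orthantBase_apply_fst hu]

/-- An exponent `d` not divisible by any `u i` determines, for each `i`, the first variable whose
power in `d` is less than in `u i`, together with that power. -/
lemma existsUnique_orthant {k : ℕ} {u : Fin k → Fin n →₀ ℕ} {d : Fin n →₀ ℕ}
    (hd : ∀ i, ¬ u i ≤ d) :
    ∃! p : ∀ i, Σ v, Fin (u i v), ∀ i, d (p i).1 = (p i).2 ∧ ∀ v < (p i).1, u i v ≤ d v := by
  have key (i : Fin k) : ∃ v, d v < u i v ∧ ∀ w < v, u i w ≤ d w := by
    have hne : {v | d v < u i v}.Nonempty := by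
      by_contra h
      exact hd i fun v ↦ not_lt.mp fun hv ↦ h ⟨v, hv⟩
    obtain ⟨v, hv, hmin⟩ := WellFounded.has_min (wellFounded_lt (α := Fin n)) _ hne
    exact ⟨v, hv, fun w hw ↦ not_lt.mp fun h ↦ hmin w h hw⟩
  choose v hv hmin using key
  refine ⟨fun i ↦ ⟨v i, d (v i), hv i⟩, fun i ↦ ⟨rfl, hmin i⟩, fun q hq ↦ funext fun i ↦ ?_⟩
  obtain ⟨hq1, hq2⟩ := hq i
  revert hq1 hq2
  rcases q i with ⟨w, c, hc⟩
  intro hq1 hq2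
  simp only at hq1 hq2
  obtain rfl : w = v i := by
    rcases lt_trichotomy w (v i) with h | h | h
    · have := hmin i w h
      omega
    · exact h
    · have := hq2 _ h
      have := hv i
      omega
  subst hq1
  rfl

theorem isStanleyIdeal_of_monomial_regular_sequence {K : Type*} [Field K] {n k : ℕ}
    (u : Fin k → (Fin n →₀ ℕ))
    (hreg : RingTheory.Sequence.IsRegular (MvPolynomial (Fin n) K)
      (List.ofFn fun i => (monomial (u i) (1 : K) : MvPolynomial (Fin n) K))) :
    quotDepth K
        (Ideal.span (Set.range fun i => (monomial (u i) (1 : K) : MvPolynomial (Fin n) K)))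
      ≤ sdepth K
        (Ideal.span (Set.range fun i => (monomial (u i) (1 : K) : MvPolynomial (Fin n) K))) := by
  have hI : Ideal.ofList (List.ofFn fun i ↦ (monomial (u i) (1 : K) : MvPolynomial (Fin n) K)) =
      Ideal.span (Set.range fun i ↦ (monomial (u i) (1 : K) : MvPolynomial (Fin n) K)) :=
    ofList_ofFn _
  have hu : ∀ i j, i ≠ j → ∀ v, u i v = 0 ∨ u j v = 0 :=
    fun i j hij ↦ eq_zero_or_eq_zero_of_isRegular_monomial K hreg hij
  have hmem (d : Fin n →₀ ℕ) : (monomial d (1 : K) : MvPolynomial (Fin n) K) ∉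
      Ideal.span (Set.range fun i ↦ (monomial (u i) (1 : K) : MvPolynomial (Fin n) K)) ↔
      ∀ i, ¬ u i ≤ d := by
    rw [← Set.image_univ, monomial_mem_span_image_iff]
    simp
  trans n - k
  · refine csSup_le' ?_
    rintro _ ⟨rs, rfl, -, hrs⟩
    rw [← hI] at hrs
    have := length_add_length_le_of_isRegular_of_isRegular_quotient K hreg hrs
    rw [List.length_ofFn] at this
    omega
  · refine le_sdepth_of_partition K ?_ (orthantBase u) (orthantFree u) ?_ ?_ fun p ↦ ?_
    · intro htop
      apply hreg.top_ne_smul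
      rw [hI, htop, Ideal.smul_eq_mul, Ideal.mul_top]
    · intro d hd
      simp_rw [mem_orthant_iff hu]
      exact existsUnique_orthant ((hmem d).mp hd)
    · intro d p hle heq
      refine (hmem d).mpr fun i hi ↦ ?_
      have h := ((mem_orthant_iff hu p d).mp ⟨hle, heq⟩ i).1
      have := hi (p i).1
      have := (p i).2.isLt
      omega
    · have : (Finset.univ.image fun i ↦ (p i).1).card ≤ k :=
        Finset.card_image_le.trans (Finset.card_fin k).le
      rw [orthantFree, Finset.card_compl, Fintype.card_fin]
      omega

end
end
end

section
/- Let K be a field, S = K[x_1,...,x_n], 1 ≤ t < n, P = (x_1,...,x_t), and let u = ∏_{i=t+1}^n x_i^{a_i} be a monomial in the remaining variables with u ≠ 1. Then the set of associated primes of the S-module S/(P,u) is exactly { (x_1,...,x_t, x_i) : t < i ≤ n and a_i ≥ 1 }. -/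
/-!
STATEMENT 12 (from the proof of Theorem 2.1): Let `K` be a field,
`S = K[x_1,…,x_n]`, `1 ≤ t < n`, `P = (x_1,…,x_t)`, and let
`u = ∏_{i=t+1}^n x_i^{a_i}` be a monomial in the remaining variables with
`u ≠ 1`.  Then `Ass(S/(P,u)) = { (x_1,…,x_t,x_i) : t < i ≤ n, a_i ≥ 1 }`.
(In `Fin n` indexing, `x_1,…,x_t` are `X i` with `i.val < t`.)
-/

open MvPolynomial

noncomputable section

namespace MvPolynomial

variable {σ R : Type*} [CommRing R]

theorem mem_span_X_image_sup_span_monomial {s : Set σ} {a : σ →₀ ℕ} {f : MvPolynomial σ R} :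
    f ∈ Ideal.span ((fun i => (X i : MvPolynomial σ R)) '' s) ⊔ Ideal.span {monomial a (1 : R)} ↔
      ∀ e, coeff e f ≠ 0 → (∃ j ∈ s, e j ≠ 0) ∨ a ≤ e := by
  have h : Ideal.span ((fun i => (X i : MvPolynomial σ R)) '' s) ⊔ Ideal.span {monomial a (1 : R)} =
      Ideal.span ((fun e => monomial e (1 : R)) '' ((fun i => Finsupp.single i 1) '' s ∪ {a})) := by
    rw [Set.image_union, Ideal.span_union, Set.image_image, Set.image_singleton]
    rfl
  rw [h, mem_ideal_span_monomial_image]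
  simp [Nat.one_le_iff_ne_zero, or_and_right, exists_or, or_comm]

theorem mem_span_X_image_sup_span_X {s : Set σ} {i : σ} {f : MvPolynomial σ R} :
    f ∈ Ideal.span ((fun i => (X i : MvPolynomial σ R)) '' s) ⊔ Ideal.span {X i} ↔
      ∀ e, coeff e f ≠ 0 → (∃ j ∈ s, e j ≠ 0) ∨ e i ≠ 0 := by
  refine mem_span_X_image_sup_span_monomial.trans ?_
  simp [Nat.one_le_iff_ne_zero]

theorem isPrime_span_X_image [IsDomain R] (s : Set σ) :
    (Ideal.span ((fun i => (X i : MvPolynomial σ R)) '' s)).IsPrime := by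
  classical
  set I := Ideal.span ((fun i => (X i : MvPolynomial σ R)) '' s)
  let φ : MvPolynomial σ R →ₐ[R] MvPolynomial σ R := aeval fun i => if i ∈ s then 0 else X i
  have hφ : (Ideal.Quotient.mkₐ R I).comp φ = Ideal.Quotient.mkₐ R I := by
    refine algHom_ext fun i => ?_
    by_cases hi : i ∈ s
    · have : (X i : MvPolynomial σ R) ∈ I := Ideal.subset_span ⟨i, hi, rfl⟩
      simp [φ, hi, Ideal.Quotient.eq_zero_iff_mem.mpr this]
    · simp [φ, hi]
  have hker : I = RingHom.ker φ := by
    refine le_antisymm (Ideal.span_le.mpr ?_) fun f hf => ?_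
    · rintro _ ⟨i, hi, rfl⟩
      simp [φ, hi]
    · have h := DFunLike.congr_fun hφ f
      rw [AlgHom.comp_apply, (RingHom.mem_ker).mp hf, map_zero] at h
      exact Ideal.Quotient.eq_zero_iff_mem.mp h.symm
  rw [hker]
  exact RingHom.ker_isPrime φ

theorem isPrime_span_X_image_sup_span_X [IsDomain R] (s : Set σ) (i : σ) :
    (Ideal.span ((fun i => (X i : MvPolynomial σ R)) '' s) ⊔ Ideal.span {X i}).IsPrime := by
  have h := isPrime_span_X_image (R := R) (s ∪ {i})
  rwa [Set.image_union, Ideal.span_union, Set.image_singleton] at h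

theorem mul_monomial_mem_span_X_image_sup_iff {s : Set σ} {b : σ →₀ ℕ} {i : σ}
    (hb : ∀ j ∈ s, b j = 0) {f : MvPolynomial σ R} :
    f * monomial b 1 ∈ Ideal.span ((fun i => (X i : MvPolynomial σ R)) '' s) ⊔
        Ideal.span {monomial (b + Finsupp.single i 1) (1 : R)} ↔
      f ∈ Ideal.span ((fun i => (X i : MvPolynomial σ R)) '' s) ⊔ Ideal.span {X i} := by
  rw [mem_span_X_image_sup_span_monomial, mem_span_X_image_sup_span_X]
  have key (e : σ →₀ ℕ) : ((∃ j ∈ s, (e + b) j ≠ 0) ∨ b + Finsupp.single i 1 ≤ e + b) ↔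
      (∃ j ∈ s, e j ≠ 0) ∨ e i ≠ 0 := by
    refine or_congr (exists_congr fun j => and_congr_right fun hj => by simp [hb j hj]) ?_
    rw [add_comm e b, add_le_add_iff_left, Finsupp.single_le_iff, Nat.one_le_iff_ne_zero]
  constructor
  · intro h e he
    exact (key e).mp (h (e + b) (by rwa [coeff_mul_monomial, mul_one]))
  · intro h e he
    rw [coeff_mul_monomial'] at he
    obtain ⟨hle, he⟩ := ite_ne_right_iff.mp he
    rw [← tsub_add_cancel_of_le hle]
    exact (key _).mpr (h _ (by rwa [mul_one] at he))

theorem mem_span_X_image_sup_of_mul_X_mem {s : Set σ} {b : σ →₀ ℕ} {i : σ} (hi : i ∉ s)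
    {f : MvPolynomial σ R}
    (hf : f * X i ∈ Ideal.span ((fun i => (X i : MvPolynomial σ R)) '' s) ⊔
      Ideal.span {monomial (b + Finsupp.single i 1) (1 : R)}) :
    f ∈ Ideal.span ((fun i => (X i : MvPolynomial σ R)) '' s) ⊔ Ideal.span {monomial b (1 : R)} := by
  rw [mem_span_X_image_sup_span_monomial] at hf ⊢
  intro e he
  refine (hf (e + Finsupp.single i 1) (by rwa [coeff_mul_X])).imp ?_ le_of_add_le_add_right
  rintro ⟨j, hj, h⟩
  refine ⟨j, hj, ?_⟩
  rwa [Finsupp.add_apply, Finsupp.single_eq_of_ne (by rintro rfl; exact hi hj), add_zero] at h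

end MvPolynomial

theorem Ideal.isAssociatedPrime_quotient_iff {R : Type*} [CommRing R] [IsNoetherianRing R]
    {I Q : Ideal R} :
    IsAssociatedPrime Q (R ⧸ I) ↔ Q.IsPrime ∧ ∃ y, ∀ f, f ∈ Q ↔ f * y ∈ I := by
  rw [isAssociatedPrime_iff, Ideal.Quotient.mk_surjective.exists]
  refine and_congr_right fun _ => exists_congr fun y => ?_
  refine SetLike.ext_iff.trans (forall_congr' fun f => iff_congr Iff.rfl ?_)
  rw [Submodule.mem_colon_singleton, Submodule.mem_bot, ← Ideal.Quotient.eq_zero_iff_mem, map_mul]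
  rfl

theorem associatedPrimes_quotient_prime_sup_monomial {K : Type*} [Field K] {n t : ℕ}
    (ht1 : 1 ≤ t) (htn : t < n)
    (a : Fin n →₀ ℕ) (ha : ∀ i : Fin n, i.val < t → a i = 0) (hane : a ≠ 0) :
    associatedPrimes (MvPolynomial (Fin n) K)
        (MvPolynomial (Fin n) K ⧸
          (Ideal.span ((fun i => (X i : MvPolynomial (Fin n) K)) '' {i : Fin n | i.val < t})
            ⊔ Ideal.span {(monomial a (1 : K) : MvPolynomial (Fin n) K)}))
      = {Q : Ideal (MvPolynomial (Fin n) K) | ∃ i : Fin n, t ≤ i.val ∧ 1 ≤ a i ∧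
          Q = Ideal.span ((fun j => (X j : MvPolynomial (Fin n) K)) '' {j : Fin n | j.val < t})
            ⊔ Ideal.span {(X i : MvPolynomial (Fin n) K)}} := by
  set s : Set (Fin n) := {i | i.val < t}
  have split {i : Fin n} (hi : 1 ≤ a i) : ∃ b : Fin n →₀ ℕ, a = b + Finsupp.single i 1 :=
    ⟨a - Finsupp.single i 1, (tsub_add_cancel_of_le (Finsupp.single_le_iff.mpr hi)).symm⟩
  have vanish {b : Fin n →₀ ℕ} {i : Fin n} (hab : a = b + Finsupp.single i 1) :
      ∀ j ∈ s, b j = 0 := fun j hj => by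
    have := ha j hj
    rw [hab, Finsupp.add_apply] at this
    omega
  ext Q
  rw [AssociatedPrimes.mem_iff, Ideal.isAssociatedPrime_quotient_iff]
  constructor
  · rintro ⟨hQ, y, hy⟩
    have hu : monomial a (1 : K) ∈ Q :=
      (hy _).mpr (Ideal.mul_mem_right _ _ (Ideal.mem_sup_right (Ideal.mem_span_singleton_self _)))
    rw [monomial_eq, map_one, one_mul, Finsupp.prod, hQ.prod_mem_iff] at hu
    obtain ⟨i, hia, hi⟩ := hu
    have hXi : (X i : MvPolynomial (Fin n) K) ∈ Q := hQ.mem_of_pow_mem _ hi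
    have hai : 1 ≤ a i := Nat.one_le_iff_ne_zero.mpr (Finsupp.mem_support_iff.mp hia)
    have his : i ∉ s := fun h => by have := ha i h; omega
    refine ⟨i, not_lt.mp his, hai, le_antisymm (fun f hf => ?_) (sup_le ?_ ?_)⟩
    · obtain ⟨b, hab⟩ := split hai
      have hb := vanish hab
      rw [hab] at hy
      have hyb := mem_span_X_image_sup_of_mul_X_mem his (by rw [mul_comm]; exact (hy _).mp hXi)
      obtain ⟨p, hp, q, hq, rfl⟩ := Submodule.mem_sup.mp hyb
      obtain ⟨z, rfl⟩ := Ideal.mem_span_singleton'.mp hq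
      have hfz := (hy f).mp hf
      rw [mul_add, Ideal.add_mem_iff_right _ (Ideal.mul_mem_left _ _ (Ideal.mem_sup_left hp)),
        ← mul_assoc, mul_monomial_mem_span_X_image_sup_iff hb] at hfz
      refine ((isPrime_span_X_image_sup_span_X s i).mem_or_mem hfz).resolve_right fun hz => ?_
      refine hQ.ne_top ((Ideal.eq_top_iff_one _).mpr ((hy 1).mpr ?_))
      rw [one_mul]
      exact add_mem (Ideal.mem_sup_left hp) ((mul_monomial_mem_span_X_image_sup_iff hb).mpr hz)
    · exact fun f hf => (hy f).mpr (Ideal.mul_mem_right _ _ (Ideal.mem_sup_left hf))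
    · rwa [Ideal.span_singleton_le_iff_mem]
  · rintro ⟨i, -, hai, rfl⟩
    obtain ⟨b, hab⟩ := split hai
    refine ⟨isPrime_span_X_image_sup_span_X s i, monomial b 1, fun f => ?_⟩
    rw [hab]
    exact (mul_monomial_mem_span_X_image_sup_iff (vanish hab)).symm

end
end
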